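/- Let S_1 ⊂ S_2 ⊂ ⋯ ⊂ S_N ⊂ I be rectangles with all inclusions strict, and set S_0 = ∅. Let x ≠ y lie in the same fiber F_t of A_{S_1,…,S_N} and put z = x − y. If for some 1 ≤ n ≤ N the table z vanishes identically on S_{n−1} but not on S_n, then ‖z‖_1 can be reduced by the set of basic moves belonging to M_{S_1,…,S_N}. -/

import Mathlib

open Finset

namespace Paper

abbrev Table (R C : ℕ) := Fin R × Fin C → ℤ

/-- The table with entry 1 in cell `a` and 0 elsewhere. -/
def e {R C : ℕ} (a : Fin R × Fin C) : Table R C := fun p => if p = a then 1 else 0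

/-- The l1-norm of an integer table. -/
def l1 {R C : ℕ} (z : Table R C) : ℤ := ∑ p : Fin R × Fin C, |z p|

/-- The configuration `A_{S_1,…,S_N}` : row sums, column sums and subtable sums. -/
def configMap {R C N : ℕ} (S : Fin N → Finset (Fin R × Fin C)) (z : Table R C) :
    (Fin R → ℤ) × (Fin C → ℤ) × (Fin N → ℤ) :=
  ⟨fun i => ∑ j, z (i, j), fun j => ∑ i, z (i, j), fun n => ∑ p ∈ S n, z p⟩

/-- A move for `A_{S_1,…,S_N}` : an integer table with vanishing row sums,
column sums and subtable sums. -/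
def IsMove {R C N : ℕ} (S : Fin N → Finset (Fin R × Fin C)) (z : Table R C) : Prop :=
  configMap S z = 0

/-- The fiber `F_t` of the configuration `A_{S_1,…,S_N}` : nonnegative integer tables
with prescribed row sums, column sums and subtable sums. -/
def Fiber {R C N : ℕ} (S : Fin N → Finset (Fin R × Fin C))
    (t : (Fin R → ℤ) × (Fin C → ℤ) × (Fin N → ℤ)) : Set (Table R C) :=
  {x | (∀ p, 0 ≤ x p) ∧ configMap S x = t}

/-- `B` is a Markov basis for the configuration `A_{S_1,…,S_N}`. -/
def IsMarkovBasis {R C N : ℕ} (S : Fin N → Finset (Fin R × Fin C))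
    (B : Set (Table R C)) : Prop :=
  B.Finite ∧ (∀ z ∈ B, IsMove S z) ∧ (∀ z ∈ B, -z ∈ B) ∧
    ∀ t, ∀ x ∈ Fiber S t, ∀ y ∈ Fiber S t, x ≠ y →
      ∃ U : ℕ, 0 < U ∧ ∃ zs : Fin U → Table R C,
        (∀ u, zs u ∈ B) ∧ y = x + ∑ u, zs u ∧
        ∀ u : Fin U, (x + ∑ s ∈ Finset.Iic u, zs s) ∈ Fiber S t

/-- `‖x − y‖₁` can be reduced by the set of moves `B` within the fiber `F`. -/
def CanReduce {R C : ℕ} (F : Set (Table R C)) (B : Set (Table R C))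
    (x y : Table R C) : Prop :=
  ∃ τp τm : ℕ, 0 < τp + τm ∧
    ∃ (Bp : Fin τp → Table R C) (Bm : Fin τm → Table R C),
      (∀ s, Bp s ∈ B) ∧ (∀ s, Bm s ∈ B) ∧
      (∀ u : Fin τp, (x + ∑ s ∈ Finset.Iic u, Bp s) ∈ F) ∧
      (∀ u : Fin τm, (y - ∑ s ∈ Finset.Iic u, Bm s) ∈ F) ∧
      l1 (x - y + ∑ s, Bp s + ∑ s, Bm s) < l1 (x - y)

/-- Basic moves (moves of Type I). -/
def IsBasicMove {R C : ℕ} (z : Table R C) : Prop :=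
  ∃ (i i' : Fin R) (j j' : Fin C), i ≠ i' ∧ j ≠ j' ∧
    z = e (i, j) + e (i', j') - e (i', j) - e (i, j')

/-- A rectangle in the set of cells. -/
def IsRectangle {R C : ℕ} (S : Finset (Fin R × Fin C)) : Prop :=
  ∃ (a₁ a₂ : Fin R) (b₁ b₂ : Fin C), a₁ < a₂ ∧ b₁ < b₂ ∧
    S = Finset.univ.filter fun p => a₁ ≤ p.1 ∧ p.1 ≤ a₂ ∧ b₁ ≤ p.2 ∧ p.2 ≤ b₂

/-- The positive part `z⁺` of a move. -/
def posPart {R C : ℕ} (z : Table R C) : Table R C := fun p => max (z p) 0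

/-- The negative part `z⁻` of a move. -/
def negPart {R C : ℕ} (z : Table R C) : Table R C := fun p => max (-z p) 0

/-- The `(k,l)` block `I_{kl}` (cells are 1-indexed in the paper, hence the `+ 1`). -/
def block {R C : ℕ} (rr cc : ℕ → ℕ) (k l : ℕ) : Finset (Fin R × Fin C) :=
  Finset.univ.filter fun p =>
    rr k ≤ p.1.1 + 1 ∧ p.1.1 + 1 < rr (k+1) ∧ cc l ≤ p.2.1 + 1 ∧ p.2.1 + 1 < cc (l+1)

/-- `S = I_{11} ∪ I_{22} ∪ ⋯ ∪ I_{NN}` : the union of the diagonal blocks. -/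
def Sdiag {R C : ℕ} (N : ℕ) (rr cc : ℕ → ℕ) : Finset (Fin R × Fin C) :=
  (Finset.Icc 1 N).biUnion fun k => block rr cc k k

/-- Two cells lie in a common block `I_{kl}` with `1 ≤ k,l ≤ Nb`. -/
def SameBlock {R C : ℕ} (Nb : ℕ) (rr cc : ℕ → ℕ) (p q : Fin R × Fin C) : Prop :=
  ∃ k l, 1 ≤ k ∧ k ≤ Nb ∧ 1 ≤ l ∧ l ≤ Nb ∧
    p ∈ block (R := R) (C := C) rr cc k l ∧ q ∈ block rr cc k l

/-- Two row indices lie in a common row block `[r_k, r_{k+1})`. -/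
def SameRowBlock {R : ℕ} (Nb : ℕ) (rr : ℕ → ℕ) (i i' : Fin R) : Prop :=
  ∃ k, 1 ≤ k ∧ k ≤ Nb ∧ rr k ≤ i.1 + 1 ∧ i.1 + 1 < rr (k+1) ∧
    rr k ≤ i'.1 + 1 ∧ i'.1 + 1 < rr (k+1)

/-- Moves of Type II: a degree-3 square-free move whose six nonzero cells
lie outside `S` and in six pairwise distinct blocks.  `Nd` bounds the index of the
diagonal blocks of `S`, `Nb` bounds the block indices. -/
def IsTypeII {R C : ℕ} (Nd Nb : ℕ) (rr cc : ℕ → ℕ) (z : Table R C) : Prop :=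
  ∃ (i₁ i₂ i₃ : Fin R) (j₁ j₂ j₃ : Fin C),
    z = e (i₁,j₂) + e (i₂,j₃) + e (i₃,j₁) - e (i₁,j₃) - e (i₂,j₁) - e (i₃,j₂) ∧
    (∀ p ∈ ([(i₁,j₂),(i₂,j₃),(i₃,j₁),(i₁,j₃),(i₂,j₁),(i₃,j₂)] : List (Fin R × Fin C)),
      p ∉ Sdiag Nd rr cc) ∧
    List.Pairwise (fun p q => ¬ SameBlock Nb rr cc p q)
      [(i₁,j₂),(i₂,j₃),(i₃,j₁),(i₁,j₃),(i₂,j₁),(i₃,j₂)]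

/-- Moves of Type III. -/
def IsTypeIII {R C : ℕ} (Nd Nb : ℕ) (rr cc : ℕ → ℕ) (z : Table R C) : Prop :=
  ∃ (i₁ i₂ i₃ : Fin R) (j₁ j₂ j₃ : Fin C),
    z = e (i₁,j₁) + e (i₂,j₃) + e (i₃,j₂) - e (i₁,j₃) - e (i₂,j₂) - e (i₃,j₁) ∧
    (∃ k l, 1 ≤ k ∧ k ≤ Nd ∧ 1 ≤ l ∧ l ≤ Nd ∧ k ≠ l ∧
      (i₁,j₁) ∈ block (R := R) (C := C) rr cc k k ∧ (i₂,j₂) ∈ block rr cc l l) ∧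
    (∀ p ∈ ([(i₂,j₃),(i₃,j₂),(i₁,j₃),(i₃,j₁)] : List (Fin R × Fin C)),
      p ∉ Sdiag Nd rr cc) ∧
    List.Pairwise (fun p q => ¬ SameBlock Nb rr cc p q) [(i₂,j₃),(i₃,j₂),(i₁,j₃),(i₃,j₁)]

/-- Moves of Type IV (row version). -/
def IsTypeIVrow {R C : ℕ} (Nd Nb : ℕ) (rr cc : ℕ → ℕ) (z : Table R C) : Prop :=
  ∃ (i₁ i₂ i₃ i₄ : Fin R) (j₁ j₂ j₃ j₄ : Fin C),
    z = e (i₁,j₁) + e (i₂,j₂) + e (i₃,j₃) + e (i₄,j₄)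
        - e (i₁,j₃) - e (i₂,j₄) - e (i₃,j₂) - e (i₄,j₁) ∧
    (∃ k l, 1 ≤ k ∧ k ≤ Nd ∧ 1 ≤ l ∧ l ≤ Nd ∧ k ≠ l ∧
      (i₁,j₁) ∈ block (R := R) (C := C) rr cc k k ∧ (i₃,j₂) ∈ block rr cc l l) ∧
    (∀ p ∈ ([(i₂,j₂),(i₃,j₃),(i₄,j₄),(i₁,j₃),(i₂,j₄),(i₄,j₁)] : List (Fin R × Fin C)),
      p ∉ Sdiag Nd rr cc) ∧
    SameRowBlock Nb rr i₁ i₂ ∧ SameRowBlock Nb rr i₃ i₄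

/-- Moves of Type IV, including the transposes of the row-version moves. -/
def IsTypeIV {R C : ℕ} (Nd Nb : ℕ) (rr cc : ℕ → ℕ) (z : Table R C) : Prop :=
  IsTypeIVrow Nd Nb rr cc z ∨
    IsTypeIVrow (R := C) (C := R) Nd Nb cc rr (fun p => z (p.2, p.1))

def mv {R C : ℕ} (i i' : Fin R) (j j' : Fin C) : Table R C :=
  e (i, j) + e (i', j') - e (i', j) - e (i, j')

lemma l1_add_e {R C : ℕ} (z : Table R C) (p : Fin R × Fin C) :
    l1 (z + e p) = l1 z + (|z p + 1| - |z p|) := by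
  unfold l1
  rw [← Finset.add_sum_erase _ _ (Finset.mem_univ p),
    ← Finset.add_sum_erase (a := p) _ (fun q => |z q|) (Finset.mem_univ p)]
  have : ∑ q ∈ Finset.univ.erase p, |(z + e p) q| = ∑ q ∈ Finset.univ.erase p, |z q| := by
    apply Finset.sum_congr rfl
    intro q hq
    simp [e, Finset.ne_of_mem_erase hq]
  rw [this]
  simp [e]
  ring

lemma l1_sub_e {R C : ℕ} (z : Table R C) (p : Fin R × Fin C) :
    l1 (z - e p) = l1 z + (|z p - 1| - |z p|) := by
  have h := l1_add_e (z - e p) p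
  simp [e] at h
  have h2 : (z - fun q => if q = p then (1:ℤ) else 0) = z - e p := rfl
  linarith

lemma l1_neg {R C : ℕ} (z : Table R C) : l1 (-z) = l1 z := by
  simp [l1]

lemma l1_mv {R C : ℕ} (z : Table R C) (i i' : Fin R) (j j' : Fin C)
    (hi : i ≠ i') (hj : j ≠ j') :
    l1 (z + mv i i' j j') = l1 z + (|z (i, j) + 1| - |z (i, j)|)
      + (|z (i', j') + 1| - |z (i', j')|) + (|z (i', j) - 1| - |z (i', j)|)
      + (|z (i, j') - 1| - |z (i, j')|) := by
  have : z + mv i i' j j' = z + e (i, j) + e (i', j') - e (i', j) - e (i, j') := by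
    unfold mv; abel
  rw [this, l1_sub_e, l1_sub_e, l1_add_e, l1_add_e]
  simp [e, hi, hj, hi.symm, hj.symm]

lemma abs_dec {a : ℤ} (h : 0 < a) : |a - 1| - |a| = -1 := by
  rw [abs_of_pos h, abs_of_nonneg (by omega)]; ring

lemma abs_inc_neg {a : ℤ} (h : a < 0) : |a + 1| - |a| = -1 := by
  rw [abs_of_neg h, abs_of_nonpos (by omega)]; ring

lemma abs_inc (a : ℤ) : |a + 1| - |a| ≤ 1 := by
  have := abs_add_le a 1
  simp at this; linarith

lemma configMap_add {R C N : ℕ} (S : Fin N → Finset (Fin R × Fin C)) (u v : Table R C) :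
    configMap S (u + v) = configMap S u + configMap S v := by
  ext <;> simp [configMap, Finset.sum_add_distrib]

lemma configMap_neg {R C N : ℕ} (S : Fin N → Finset (Fin R × Fin C)) (u : Table R C) :
    configMap S (-u) = - configMap S u := by
  ext <;> simp [configMap]

lemma isMove_mv {R C N : ℕ} (S : Fin N → Finset (Fin R × Fin C)) (i i' : Fin R) (j j' : Fin C)
    (h : ∀ n, (((i, j) ∈ S n ↔ (i', j) ∈ S n) ∧ ((i, j') ∈ S n ↔ (i', j') ∈ S n)) ∨
      (((i, j) ∈ S n ↔ (i, j') ∈ S n) ∧ ((i', j) ∈ S n ↔ (i', j') ∈ S n))) :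
    IsMove S (mv i i' j j') := by
  unfold IsMove
  ext n
  · simp [configMap, mv, e, Finset.sum_add_distrib, Finset.sum_sub_distrib, Prod.ext_iff,
      ite_and]
  · simp [configMap, mv, e, Finset.sum_add_distrib, Finset.sum_sub_distrib, Prod.ext_iff,
      ite_and]
  · simp [configMap, mv, e, Finset.sum_add_distrib, Finset.sum_sub_distrib]
    rcases h n with ⟨h1, h2⟩ | ⟨h1, h2⟩ <;> simp [h1, h2]

def BM {R C N : ℕ} (S : Fin N → Finset (Fin R × Fin C)) : Set (Table R C) :=
  {z | IsBasicMove z ∧ IsMove S z}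

lemma BM_neg {R C N : ℕ} (S : Fin N → Finset (Fin R × Fin C)) (z : Table R C) (h : z ∈ BM S) :
    -z ∈ BM S := by
  obtain ⟨⟨i, i', j, j', hi, hj, hz⟩, hm⟩ := h
  refine ⟨⟨i', i, j, j', hi.symm, hj, ?_⟩, ?_⟩
  · rw [hz]; abel
  · unfold IsMove at *; rw [configMap_neg, hm]; simp

lemma CanReduce.swap {R C N : ℕ} (S : Fin N → Finset (Fin R × Fin C)) (F : Set (Table R C))
    (x y : Table R C) (h : CanReduce F (BM S) y x) : CanReduce F (BM S) x y := by
  obtain ⟨p, m, hpos, Bp, Bm, h1, h2, h3, h4, h5⟩ := h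
  refine ⟨m, p, by omega, fun s => - Bm s, fun s => - Bp s, fun s => BM_neg S _ (h2 s),
    fun s => BM_neg S _ (h1 s), ?_, ?_, ?_⟩
  · intro u
    have := h4 u
    rwa [Finset.sum_neg_distrib, ← sub_eq_add_neg]
  · intro u
    have := h3 u
    rwa [Finset.sum_neg_distrib, sub_neg_eq_add]
  · rw [← l1_neg, ← l1_neg (x - y)]
    simp only [Finset.sum_neg_distrib]
    convert h5 using 2 <;> abel

lemma CanReduce.single {R C : ℕ} (F B : Set (Table R C)) (x y m : Table R C) (hm : m ∈ B)
    (hF : x + m ∈ F) (hl : l1 (x + m - y) < l1 (x - y)) : CanReduce F B x y := by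
  refine ⟨1, 0, by omega, fun _ => m, Fin.elim0, fun _ => hm, fun s => s.elim0, ?_,
    fun s => s.elim0, ?_⟩
  · intro u
    have : Finset.Iic u = {u} := by
      ext v; simp [Subsingleton.elim v u]
    simpa [this] using hF
  · simp only [Finset.univ_unique, Finset.sum_singleton, Finset.univ_eq_empty, Finset.sum_empty]
    convert hl using 2
    abel

lemma CanReduce.step {R C : ℕ} (F B : Set (Table R C)) (x y m : Table R C) (hm : m ∈ B)
    (hF : x + m ∈ F) (hl : l1 (x + m - y) ≤ l1 (x - y)) (h : CanReduce F B (x + m) y) :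
    CanReduce F B x y := by
  obtain ⟨p, q, hpos, Bp, Bm, h1, h2, h3, h4, h5⟩ := h
  refine ⟨p + 1, q, by omega, Fin.cons m Bp, Bm, ?_, h2, ?_, h4, ?_⟩
  · intro s
    refine Fin.cases ?_ ?_ s
    · simpa using hm
    · intro s; simpa using h1 s
  · intro u
    refine Fin.cases ?_ ?_ u
    · have : Finset.Iic (0 : Fin (p+1)) = {0} := by
        ext v; simp
      simpa [this] using hF
    · intro u
      have : Finset.Iic (Fin.succ u) = insert 0 ((Finset.Iic u).image Fin.succ) := by
        ext v
        refine Fin.cases ?_ ?_ v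
        · simp
        · intro v; simp
      rw [this, Finset.sum_insert (by simp), Finset.sum_image (by simp)]
      have := h3 u
      simp only [Fin.cons_zero, Fin.cons_succ]
      rwa [← add_assoc]
  · refine lt_of_lt_of_le ?_ hl
    have e1 : x - y + ∑ s, (Fin.cons m Bp : Fin (p + 1) → Table R C) s + ∑ s, Bm s
        = x + m - y + ∑ s, Bp s + ∑ s, Bm s := by
      rw [Fin.sum_univ_succ]
      simp only [Fin.cons_zero, Fin.cons_succ]
      abel
    rw [e1]
    exact h5

/-- data of the situation -/
structure Sit {R C N : ℕ} (S : ℕ → Finset (Fin R × Fin C))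
    (t : (Fin R → ℤ) × (Fin C → ℤ) × (Fin N → ℤ)) (A : ℕ → Fin R → Prop) (B : ℕ → Fin C → Prop)
    (P : ℕ) (x y : Table R C) : Prop where
  prod : ∀ m, m ≤ N → ∀ i j, (i, j) ∈ S m ↔ A m i ∧ B m j
  Amono : ∀ m k, m ≤ k → k ≤ N → ∀ i, A m i → A k i
  Bmono : ∀ m k, m ≤ k → k ≤ N → ∀ j, B m j → B k j
  hP : P + 1 ≤ N
  hx : x ∈ Fiber (fun n : Fin N => S (n.1 + 1)) t
  hy : y ∈ Fiber (fun n : Fin N => S (n.1 + 1)) t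
  hz : ∀ i j, A P i → B P j → x (i, j) = y (i, j)

section

variable {R C N : ℕ} {S : ℕ → Finset (Fin R × Fin C)}
    {t : (Fin R → ℤ) × (Fin C → ℤ) × (Fin N → ℤ)} {A : ℕ → Fin R → Prop} {B : ℕ → Fin C → Prop}
    {P : ℕ} {x y : Table R C}

lemma Sit.swap (h : Sit S t A B P x y) : Sit S t A B P y x :=
  ⟨h.prod, h.Amono, h.Bmono, h.hP, h.hy, h.hx, fun i j a b => (h.hz i j a b).symm⟩

lemma Sit.mv_mem (h : Sit S t A B P x y) {i i' : Fin R} {j j' : Fin C} (hi : i ≠ i') (hj : j ≠ j')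
    (h1 : (¬ A P i ∧ ¬ A P i') ∨ (¬ B P j ∧ ¬ B P j'))
    (h2 : (A (P+1) i ∧ A (P+1) i') ∨ (B (P+1) j ∧ B (P+1) j')) :
    mv i i' j j' ∈ BM (fun n : Fin N => S (n.1 + 1)) := by
  refine ⟨⟨i, i', j, j', hi, hj, rfl⟩, isMove_mv _ _ _ _ _ ?_⟩
  intro n
  have hn : n.1 + 1 ≤ N := n.2
  have hP := h.hP
  simp only [h.prod _ hn]
  by_cases hle : n.1 + 1 ≤ P
  · have a := h.Amono _ P hle (by omega)
    have b := h.Bmono _ P hle (by omega)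
    rcases h1 with ⟨u, v⟩ | ⟨u, v⟩
    · have u' := mt (a i) u
      have v' := mt (a i') v
      left; simp [u', v']
    · have u' := mt (b j) u
      have v' := mt (b j') v
      right; simp [u', v']
  · have a := h.Amono (P+1) (n.1+1) (by omega) hn
    have b := h.Bmono (P+1) (n.1+1) (by omega) hn
    rcases h2 with ⟨u, v⟩ | ⟨u, v⟩
    · left; simp [a i u, a i' v]
    · right; simp [b j u, b j' v]

lemma Sit.fib (h : Sit S t A B P x y) {i i' : Fin R} {j j' : Fin C} (hi : i ≠ i') (hj : j ≠ j')
    (hm : mv i i' j j' ∈ BM (fun n : Fin N => S (n.1 + 1)))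
    (p1 : y (i', j) < x (i', j)) (p2 : y (i, j') < x (i, j')) :
    x + mv i i' j j' ∈ Fiber (fun n : Fin N => S (n.1 + 1)) t := by
  refine ⟨?_, ?_⟩
  · rintro ⟨a, b⟩
    have hx0 := h.hx.1 (a, b)
    have hy1 := h.hy.1 (i', j)
    have hy2 := h.hy.1 (i, j')
    simp only [mv, e, Pi.add_apply, Pi.sub_apply, Prod.mk.injEq]
    by_cases c1 : a = i' ∧ b = j
    · obtain ⟨rfl, rfl⟩ := c1
      simp [hi.symm, hj, hi]
      omega
    · by_cases c2 : a = i ∧ b = j'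
      · obtain ⟨rfl, rfl⟩ := c2
        simp [hi, hj.symm]
        omega
      · simp only [c1, c2, if_false]
        split_ifs <;> omega
  · have := hm.2
    unfold IsMove at this
    rw [configMap_add, this, h.hx.2, add_zero]

lemma Sit.l1_le (i i' : Fin R) (j j' : Fin C) (hi : i ≠ i') (hj : j ≠ j')
    (p1 : y (i', j) < x (i', j)) (p2 : y (i, j') < x (i, j')) :
    l1 (x + mv i i' j j' - y) ≤ l1 (x - y) ∧
      (x (i, j) < y (i, j) → l1 (x + mv i i' j j' - y) < l1 (x - y)) := by
  have e1 : x + mv i i' j j' - y = (x - y) + mv i i' j j' := by abel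
  rw [e1, l1_mv _ _ _ _ _ hi hj]
  simp only [Pi.sub_apply]
  have d1 := abs_dec (sub_pos.2 p1)
  have d2 := abs_dec (sub_pos.2 p2)
  have d3 := abs_inc (x (i', j') - y (i', j'))
  have d4 := abs_inc (x (i, j) - y (i, j))
  refine ⟨by linarith, fun hlt => ?_⟩
  have d5 := abs_inc_neg (sub_neg.2 hlt)
  linarith

lemma Sit.three (h : Sit S t A B P x y) {i i' : Fin R} {j j' : Fin C}
    (h1 : (¬ A P i ∧ ¬ A P i') ∨ (¬ B P j ∧ ¬ B P j'))
    (h2 : (A (P+1) i ∧ A (P+1) i') ∨ (B (P+1) j ∧ B (P+1) j'))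
    (p1 : y (i', j) < x (i', j)) (p2 : y (i, j') < x (i, j')) (p3 : x (i, j) < y (i, j)) :
    CanReduce (Fiber (fun n : Fin N => S (n.1 + 1)) t) (BM (fun n : Fin N => S (n.1 + 1))) x y := by
  have hi : i ≠ i' := by rintro rfl; omega
  have hj : j ≠ j' := by rintro rfl; omega
  have hm := h.mv_mem hi hj h1 h2
  exact CanReduce.single _ _ _ _ _ hm (h.fib hi hj hm p1 p2) ((Sit.l1_le i i' j j' hi hj p1 p2).2 p3)

lemma Sit.row_pos (h : Sit S t A B P x y) (i : Fin R) (j : Fin C) (hneg : x (i, j) < y (i, j)) :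
    ∃ k, y (i, k) < x (i, k) := by
  by_contra hc
  push Not at hc
  have e1 : ∑ j, x (i, j) = ∑ j, y (i, j) := by
    have := h.hx.2.trans h.hy.2.symm
    exact congrFun (congrArg (fun q => q.1) this) i
  have := Finset.sum_lt_sum (s := Finset.univ) (fun k _ => hc k) ⟨j, Finset.mem_univ _, hneg⟩
  omega

lemma Sit.col_pos (h : Sit S t A B P x y) (i : Fin R) (j : Fin C) (hneg : x (i, j) < y (i, j)) :
    ∃ k, y (k, j) < x (k, j) := by
  by_contra hc
  push Not at hc
  have e1 : ∑ i, x (i, j) = ∑ i, y (i, j) := by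
    have := h.hx.2.trans h.hy.2.symm
    exact congrFun (congrArg (fun q => q.2.1) this) j
  have := Finset.sum_lt_sum (s := Finset.univ) (fun k _ => hc k) ⟨i, Finset.mem_univ _, hneg⟩
  omega

lemma Sit.case1' (h : Sit S t A B P x y) {i : Fin R} {j j' : Fin C}
    (hB : B (P+1) j) (hB' : B (P+1) j')
    (hp : y (i, j) < x (i, j)) (hn : x (i, j') < y (i, j'))
    (hc : (¬ B P j ∧ ¬ B P j') ∨ B P j') :
    CanReduce (Fiber (fun n : Fin N => S (n.1 + 1)) t) (BM (fun n : Fin N => S (n.1 + 1))) x y := by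
  obtain ⟨i', hi'⟩ := h.col_pos i j' hn
  refine h.three (i := i) (i' := i') (j := j') (j' := j) ?_ (Or.inr ⟨hB', hB⟩) hi' hp hn
  rcases hc with ⟨a, b⟩ | b
  · exact Or.inr ⟨b, a⟩
  · refine Or.inl ⟨fun ha => ?_, fun ha => ?_⟩
    · have := h.hz _ _ ha b; omega
    · have := h.hz _ _ ha b; omega

lemma Sit.case1 (h : Sit S t A B P x y) {i : Fin R} {j j' : Fin C}
    (hB : B (P+1) j) (hB' : B (P+1) j')
    (hp : y (i, j) < x (i, j)) (hn : x (i, j') < y (i, j')) :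
    CanReduce (Fiber (fun n : Fin N => S (n.1 + 1)) t) (BM (fun n : Fin N => S (n.1 + 1))) x y := by
  by_cases hb' : B P j'
  · exact h.case1' hB hB' hp hn (Or.inr hb')
  by_cases hb : B P j
  · exact CanReduce.swap _ _ _ _ (h.swap.case1' hB' hB hn hp (Or.inr hb))
  · exact h.case1' hB hB' hp hn (Or.inl ⟨hb, hb'⟩)

lemma Sit.case2 (h : Sit S t A B P x y) {i i' : Fin R} {j j' : Fin C}
    (hA : A (P+1) i) (hA' : A (P+1) i')
    (hB : B (P+1) j) (hB' : B (P+1) j')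
    (hp : y (i, j) < x (i, j)) (hn : x (i', j') < y (i', j'))
    (hc : ¬ B P j ∨ (¬ A P i ∧ ¬ A P i')) :
    CanReduce (Fiber (fun n : Fin N => S (n.1 + 1)) t) (BM (fun n : Fin N => S (n.1 + 1))) x y := by
  by_cases hii : i' = i
  · subst hii; exact h.case1 hB hB' hp hn
  obtain ⟨k, hk⟩ := h.row_pos i' j' hn
  by_cases hBk : B (P+1) k
  · exact h.case1 hBk hB' hk hn
  have hBk' : ¬ B P k := fun hb => hBk (h.Bmono P (P+1) (by omega) h.hP k hb)
  have hjk : j ≠ k := by rintro rfl; exact hBk hB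
  have hjk' : j' ≠ k := by rintro rfl; exact hBk hB'
  have hadm : (¬ A P i' ∧ ¬ A P i) ∨ (¬ B P j ∧ ¬ B P k) := by tauto
  by_cases hs : x (i', j) < y (i', j)
  · exact h.three hadm (Or.inl ⟨hA', hA⟩) hp hk hs
  have hjj : j ≠ j' := by rintro rfl; exact hs hn
  have hm := h.mv_mem hii hjk hadm (Or.inl ⟨hA', hA⟩)
  have hf := h.fib hii hjk hm hp hk
  refine CanReduce.step _ _ _ _ _ hm hf (Sit.l1_le _ _ _ _ hii hjk hp hk).1 ?_
  have hsit : Sit S t A B P (x + mv i' i j k) y := by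
    refine ⟨h.prod, h.Amono, h.Bmono, h.hP, hf, h.hy, ?_⟩
    intro a b ha hb
    have h0 := h.hz a b ha hb
    have c1 : ¬ (a = i' ∧ b = j) := by rintro ⟨rfl, rfl⟩; tauto
    have c2 : ¬ (a = i ∧ b = k) := by rintro ⟨rfl, rfl⟩; tauto
    have c3 : ¬ (a = i ∧ b = j) := by rintro ⟨rfl, rfl⟩; omega
    have c4 : ¬ (a = i' ∧ b = k) := by rintro ⟨rfl, rfl⟩; omega
    simp [mv, e, c1, c2, c3, c4, h0]
  refine hsit.case1 (i := i') (j := j) (j' := j') hB hB' ?_ ?_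
  · simp [mv, e, hii, hjk]
    omega
  · simp [mv, e, hii, hjk', hjj.symm]
    omega

lemma Sit.main (h : Sit S t A B P x y) {i i' : Fin R} {j j' : Fin C}
    (hA : A (P+1) i) (hA' : A (P+1) i')
    (hB : B (P+1) j) (hB' : B (P+1) j')
    (hp : y (i, j) < x (i, j)) (hn : x (i', j') < y (i', j')) :
    CanReduce (Fiber (fun n : Fin N => S (n.1 + 1)) t) (BM (fun n : Fin N => S (n.1 + 1))) x y := by
  by_cases hb : B P j
  · have ha : ¬ A P i := fun ha => by have := h.hz _ _ ha hb; omega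
    by_cases hb' : B P j'
    · have ha' : ¬ A P i' := fun ha => by have := h.hz _ _ ha hb'; omega
      exact h.case2 hA hA' hB hB' hp hn (Or.inr ⟨ha, ha'⟩)
    · exact CanReduce.swap _ _ _ _ (h.swap.case2 hA' hA hB' hB hn hp (Or.inl hb'))
  · exact h.case2 hA hA' hB hB' hp hn (Or.inl hb)

end

/-- in the change point model, if `z = x − y` vanishes on `S_{n−1}`
but not on `S_n`, then `‖z‖₁` can be reduced by the basic moves in `M_{S_1,…,S_N}`. -/
theorem changePoint_reduce_of_vanish_prev (R C N : ℕ) (hN : 1 ≤ N)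
    (S : ℕ → Finset (Fin R × Fin C)) (hS0 : S 0 = ∅)
    (hrect : ∀ n, 1 ≤ n → n ≤ N → IsRectangle (S n))
    (hchain : ∀ n m, 1 ≤ n → n < m → m ≤ N → S n ⊂ S m)
    (htop : S N ⊂ Finset.univ)
    (t : (Fin R → ℤ) × (Fin C → ℤ) × (Fin N → ℤ))
    (x y : Table R C)
    (hx : x ∈ Fiber (fun n : Fin N => S (n.1 + 1)) t)
    (hy : y ∈ Fiber (fun n : Fin N => S (n.1 + 1)) t)
    (hxy : x ≠ y)
    (n : ℕ) (hn1 : 1 ≤ n) (hnN : n ≤ N)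
    (hprev : ∀ p ∈ S (n - 1), x p - y p = 0)
    (hcur : ¬ ∀ p ∈ S n, x p - y p = 0) :
    CanReduce (Fiber (fun n : Fin N => S (n.1 + 1)) t)
      {z | IsBasicMove z ∧ IsMove (fun n : Fin N => S (n.1 + 1)) z} x y := by
  obtain ⟨P, rfl⟩ : ∃ P, n = P + 1 := ⟨n - 1, by omega⟩
  simp only [Nat.add_sub_cancel] at hprev
  have hmono : ∀ m k, m ≤ k → k ≤ N → S m ⊆ S k := by
    intro m k hmk hk
    rcases Nat.eq_zero_or_pos m with rfl | hm
    · simp [hS0]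
    · rcases hmk.eq_or_lt with rfl | hlt
      · exact Finset.Subset.refl _
      · exact (hchain m k hm hlt hk).1
  have hsit : Sit (N := N) S t (fun m i => ∃ j, (i, j) ∈ S m) (fun m j => ∃ i, (i, j) ∈ S m)
      P x y := by
    have hprod : ∀ m, m ≤ N → ∀ i j, (i, j) ∈ S m ↔ (∃ j, (i, j) ∈ S m) ∧ ∃ i, (i, j) ∈ S m := by
      intro m hm i j
      refine ⟨fun h => ⟨⟨j, h⟩, ⟨i, h⟩⟩, ?_⟩
      rintro ⟨⟨j', h1⟩, ⟨i', h2⟩⟩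
      rcases Nat.eq_zero_or_pos m with rfl | hm'
      · simp [hS0] at h1
      · obtain ⟨a₁, a₂, b₁, b₂, _, _, hS⟩ := hrect m hm' hm
        rw [hS] at h1 h2 ⊢
        simp only [Finset.mem_filter, Finset.mem_univ, true_and] at h1 h2 ⊢
        tauto
    refine ⟨hprod, ?_, ?_, hnN, hx, hy, ?_⟩
    · rintro m k hmk hk i ⟨j, hj⟩
      exact ⟨j, hmono m k hmk hk hj⟩
    · rintro m k hmk hk j ⟨i, hi⟩
      exact ⟨i, hmono m k hmk hk hi⟩
    · intro i j ha hb
      exact sub_eq_zero.1 (hprev _ ((hprod P (by omega) i j).2 ⟨ha, hb⟩))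
  have hsum : ∑ p ∈ S (P + 1), x p = ∑ p ∈ S (P + 1), y p := by
    have := hx.2.trans hy.2.symm
    exact congrFun (congrArg (fun q => q.2.2) this) ⟨P, by omega⟩
  push Not at hcur
  obtain ⟨p, hpS, hpne⟩ := hcur
  have hpos : ∃ q ∈ S (P + 1), y q < x q := by
    by_contra hc
    push Not at hc
    have := Finset.sum_lt_sum hc ⟨p, hpS, lt_of_le_of_ne (hc p hpS) (fun h => hpne (by omega))⟩
    omega
  have hneg : ∃ q ∈ S (P + 1), x q < y q := by
    by_contra hc
    push Not at hc
    have := Finset.sum_lt_sum hc ⟨p, hpS, lt_of_le_of_ne (hc p hpS) (fun h => hpne (by omega))⟩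
    omega
  obtain ⟨⟨i, j⟩, hq, hq'⟩ := hpos
  obtain ⟨⟨i', j'⟩, hr, hr'⟩ := hneg
  exact hsit.main ⟨j, hq⟩ ⟨j', hr⟩ ⟨i, hq⟩ ⟨i', hr⟩ hq' hr'


end Paper
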